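/- For complex ν with Re ν > -1: ∫_{-1}^1 [P_ν(x)]³ (1-x²)^{(ν-1)/2} dx = (8(ν+2)/(2ν+5)) ∫_{-1}^1 P_{ν+2}(x) [P_{ν+1}(x)]² (1-x²)^{(ν-1)/2} dx. -/

import Mathlib

open Real MeasureTheory intervalIntegral Complex

/-- Complete elliptic integral of the first kind. -/
noncomputable def ellipticK (k : ℝ) : ℝ :=
  ∫ θ in (0:ℝ)..(π/2), (1 - k ^ 2 * Real.sin θ ^ 2) ^ (-(1/2 : ℝ))

/-- Complete elliptic integral of the second kind. -/
noncomputable def ellipticE (k : ℝ) : ℝ :=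
  ∫ θ in (0:ℝ)..(π/2), (1 - k ^ 2 * Real.sin θ ^ 2) ^ ((1/2 : ℝ))

/-- Legendre function of the first kind of degree ν : P_ν(1-2z) = ₂F₁(-ν, ν+1; 1; z). -/
noncomputable def legendreP (ν : ℂ) (x : ℂ) : ℂ :=
  ordinaryHypergeometric (-ν) (ν + 1) 1 ((1 - x) / 2)

noncomputable def lc (ν : ℂ) (n : ℕ) : ℂ :=
  ((n.factorial : ℂ)⁻¹ * (ascPochhammer ℂ n).eval (-ν) *
      (ascPochhammer ℂ n).eval (ν + 1) * ((ascPochhammer ℂ n).eval 1)⁻¹)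

lemma lc_zero (ν : ℂ) : lc ν 0 = 1 := by simp [lc]

lemma lc_succ (ν : ℂ) (n : ℕ) :
    lc ν (n + 1) * (n + 1) ^ 2 = lc ν n * ((n - ν) * (n + ν + 1)) := by
  have h : (n : ℂ) + 1 ≠ 0 := by exact_mod_cast n.succ_ne_zero
  have h2 : (n.factorial : ℂ) ≠ 0 := by exact_mod_cast n.factorial_ne_zero
  simp only [lc, ascPochhammer_succ_eval, ascPochhammer_eval_one, Nat.factorial_succ]
  push_cast
  rw [show (1 : ℂ) + n = n + 1 by ring]
  field_simp
  ring

lemma lc_R1 (ν : ℂ) (m : ℕ) :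
    lc (ν + 1) (m + 1) * (m + 1) ^ 2 = - lc ν m * ((ν + 1 + m) * (ν + 2 + m)) := by
  induction m with
  | zero =>
    have := lc_succ (ν + 1) 0
    simp [lc_zero] at *
    rw [this]; ring
  | succ m ih =>
    have h : (m : ℂ) + 1 ≠ 0 := by exact_mod_cast m.succ_ne_zero
    have h1 := lc_succ (ν + 1) (m + 1)
    have h2 := lc_succ ν m
    push_cast at *
    rw [h1]
    apply mul_right_cancel₀ (pow_ne_zero 2 h)
    linear_combination ((m + 1 - (ν + 1)) * (m + 1 + (ν + 1) + 1)) * ih +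
      ((ν + 1 + (m + 1)) * (ν + 2 + (m + 1))) * h2

lemma lc_R2 (ν : ℂ) (m : ℕ) :
    lc ν m * (ν + 1 + m) = lc (ν + 1) m * (ν + 1 - m) := by
  induction m with
  | zero => simp [lc_zero]
  | succ m ih =>
    have h : (m : ℂ) + 1 ≠ 0 := by exact_mod_cast m.succ_ne_zero
    have h1 := lc_succ (ν + 1) m
    have h2 := lc_succ ν m
    push_cast at *
    apply mul_right_cancel₀ (pow_ne_zero 2 h)
    linear_combination (m - ν) * (ν + 2 + m) * ih + (ν + 1 + (m + 1)) * h2 - (ν - m) * h1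

lemma lc_bound (ν : ℂ) : ∃ C : ℝ, 0 ≤ C ∧ ∀ n : ℕ, ‖lc ν (n + 1)‖ ≤ C / (n + 1) := by
  set K := ‖ν * (ν + 1)‖ with hK
  have hK0 : 0 ≤ K := norm_nonneg _
  have key : ∀ n : ℕ, ‖lc ν (n + 1)‖ * (n + 1) ≤ ‖lc ν 1‖ * Real.exp (K * (1 - 1 / (n + 1))) := by
    intro n
    induction n with
    | zero => simp
    | succ n ih =>
      have h1 : (0 : ℝ) < n + 1 := by positivity
      have h2 : (0 : ℝ) < n + 2 := by positivity
      have h3 : (n : ℂ) + 1 ≠ 0 := by exact_mod_cast n.succ_ne_zero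
      have h4 : (n : ℂ) + 2 ≠ 0 := by exact_mod_cast (n + 1).succ_ne_zero
      have e : lc ν (n + 2) * (n + 2) = lc ν (n + 1) * (n + 1) *
          (1 - ν * (ν + 1) / ((n + 1) * (n + 2))) := by
        have := lc_succ ν (n + 1)
        push_cast at this
        rw [show n + 1 + 1 = n + 2 by rfl] at this
        field_simp
        linear_combination this
      have e1 : ‖lc ν (n + 2)‖ * (n + 2) = ‖lc ν (n + 1)‖ * (n + 1) *
          ‖(1 - ν * (ν + 1) / ((n + 1) * (n + 2)) : ℂ)‖ := by
        have := congrArg norm e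
        rw [norm_mul, norm_mul, norm_mul] at this
        rw [show ‖(n : ℂ) + 2‖ = n + 2 by
            rw [show (n : ℂ) + 2 = ((n + 2 : ℕ) : ℂ) by push_cast; rfl, Complex.norm_natCast]; push_cast; rfl,
          show ‖(n : ℂ) + 1‖ = n + 1 by
            rw [show (n : ℂ) + 1 = ((n + 1 : ℕ) : ℂ) by push_cast; rfl, Complex.norm_natCast]; push_cast; rfl] at this
        exact this
      have e2 : ‖(1 - ν * (ν + 1) / ((n + 1) * (n + 2)) : ℂ)‖ ≤ Real.exp (K / ((n + 1) * (n + 2))) := by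
        calc _ ≤ ‖(1 : ℂ)‖ + ‖(ν * (ν + 1) / ((n + 1) * (n + 2)) : ℂ)‖ := norm_sub_le _ _
          _ = 1 + K / ((n + 1) * (n + 2)) := by
            rw [norm_one, norm_div, ← hK]
            congr 2
            rw [show ((n : ℂ) + 1) * (n + 2) = (((n + 1) * (n + 2) : ℕ) : ℂ) by push_cast; rfl,
              Complex.norm_natCast]; push_cast; rfl
          _ ≤ _ := by rw [add_comm]; exact Real.add_one_le_exp _
      push_cast
      rw [show n + 1 + 1 = n + 2 by rfl, show (n : ℝ) + 1 + 1 = n + 2 by ring, e1]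
      calc _ ≤ (‖lc ν 1‖ * Real.exp (K * (1 - 1 / (n + 1)))) * Real.exp (K / ((n + 1) * (n + 2))) := by
            gcongr
        _ = _ := by
            rw [mul_assoc, ← Real.exp_add]
            congr 2
            field_simp
            ring
  refine ⟨‖lc ν 1‖ * Real.exp K, by positivity, fun n => ?_⟩
  have h1 : (0 : ℝ) < n + 1 := by positivity
  rw [le_div_iff₀ h1]
  refine (key n).trans ?_
  gcongr
  have : 0 ≤ 1 / ((n : ℝ) + 1) := by positivity
  nlinarith

lemma lc_bdd (ν : ℂ) : ∃ C : ℝ, 0 ≤ C ∧ ∀ n : ℕ, ‖lc ν n‖ ≤ C := by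
  obtain ⟨C, hC, h⟩ := lc_bound ν
  refine ⟨1 + C, by positivity, fun n => ?_⟩
  cases n with
  | zero => simp [lc_zero, hC]
  | succ n =>
    refine (h n).trans ?_
    have : C / (n + 1) ≤ C := div_le_self hC (by have : (0:ℝ) ≤ n := by positivity
                                                 linarith)
    linarith

noncomputable def lF (ν z : ℂ) : ℂ := ∑' n, lc ν n * z ^ n
noncomputable def lD (ν z : ℂ) : ℂ := ∑' n, lc ν n * (n * z ^ (n - 1))

lemma legendreP_eq (ν x : ℂ) : legendreP ν x = lF ν ((1 - x) / 2) := by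
  rw [legendreP, ordinaryHypergeometric_eq_tsum]
  rfl

lemma lF_summ (ν z : ℂ) (hz : ‖z‖ < 1) : Summable (fun n => lc ν n * z ^ n) := by
  obtain ⟨C, hC, h⟩ := lc_bdd ν
  refine Summable.of_norm_bounded ((summable_geometric_of_lt_one (norm_nonneg z) hz).mul_left C) ?_
  intro n
  rw [norm_mul, norm_pow]
  gcongr
  exact h n

lemma summ_aux {r : ℝ} (hr0 : 0 < r) (hr1 : r < 1) (C : ℝ) :
    Summable (fun n : ℕ => C * (n * r ^ (n - 1))) := by
  have := summable_pow_mul_geometric_of_norm_lt_one 1 (r := r) (by rwa [Real.norm_of_nonneg hr0.le])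
  refine ((this.mul_left r⁻¹).mul_left C).congr fun n => ?_
  congr 1
  cases n with
  | zero => simp
  | succ n => rw [pow_succ]; field_simp; simp; ring

lemma lD_summ (ν z : ℂ) (hz : ‖z‖ < 1) : Summable (fun n : ℕ => lc ν n * (n * z ^ (n - 1))) := by
  obtain ⟨C, hC, h⟩ := lc_bdd ν
  obtain ⟨r, h1, h2⟩ := exists_between hz
  have hr : 0 < r := (norm_nonneg z).trans_lt h1
  refine Summable.of_norm_bounded (summ_aux hr h2 C) ?_
  intro n
  rw [norm_mul, norm_mul, norm_pow, Complex.norm_natCast]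
  gcongr
  exact h n

lemma lF_deriv (ν z : ℂ) (hz : ‖z‖ < 1) : HasDerivAt (lF ν) (lD ν z) z := by
  obtain ⟨C, hC, h⟩ := lc_bdd ν
  obtain ⟨r, h1, h2⟩ := exists_between hz
  have hr : 0 < r := (norm_nonneg z).trans_lt h1
  refine hasDerivAt_tsum_of_isPreconnected (u := fun n : ℕ => C * (n * r ^ (n - 1)))
    (t := Metric.ball (0 : ℂ) r) (y₀ := 0) (g := fun n z => lc ν n * z ^ n)
    (g' := fun n z => lc ν n * (n * z ^ (n - 1)))
    (summ_aux hr h2 C) Metric.isOpen_ball (convex_ball _ _).isPreconnected ?_ ?_ ?_ ?_ ?_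
  · intro n y _
    exact (hasDerivAt_pow n y).const_mul _
  · intro n y hy
    rw [mem_ball_zero_iff] at hy
    rw [norm_mul, norm_mul, norm_pow, Complex.norm_natCast]
    gcongr
    exact h n
  · simpa using hr
  · exact lF_summ ν 0 (by simp)
  · simpa using h1

lemma has_F (ν z : ℂ) (hz : ‖z‖ < 1) : HasSum (fun n => lc ν n * z ^ n) (lF ν z) :=
  (lF_summ ν z hz).hasSum

lemma has_F1 (ν z : ℂ) (hz : ‖z‖ < 1) :
    HasSum (fun n => lc ν (n + 1) * z ^ (n + 1)) (lF ν z - 1) := by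
  have := (hasSum_nat_add_iff' 1).2 (has_F ν z hz)
  simpa [lc_zero] using this

lemma has_D (ν z : ℂ) (hz : ‖z‖ < 1) :
    HasSum (fun n : ℕ => lc ν n * n * z ^ n) (z * lD ν z) := by
  refine ((lD_summ ν z hz).hasSum.mul_left z).congr_fun ?_
  intro n
  cases n with
  | zero => simp
  | succ n => simp [pow_succ]; ring

lemma has_D1 (ν z : ℂ) (hz : ‖z‖ < 1) :
    HasSum (fun n : ℕ => lc ν (n + 1) * (n + 1) * z ^ (n + 1)) (z * lD ν z) := by
  have := (hasSum_nat_add_iff' 1).2 (has_D ν z hz)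
  simpa using this

lemma lF_rel1 (ν z : ℂ) (hz : ‖z‖ < 1) :
    -2 * z * (1 - z) * lD ν z = (ν + 1) * ((1 - 2 * z) * lF ν z - lF (ν + 1) z) := by
  have hL := ((has_D1 ν z hz).sub ((has_D ν z hz).mul_left z)).mul_left (-2)
  have hR := (((has_F1 ν z hz).sub ((has_F ν z hz).mul_left (2 * z))).sub
    (has_F1 (ν + 1) z hz)).mul_left (ν + 1)
  have := hL.unique (hR.congr_fun ?_)
  · linear_combination this
  intro n
  have h : (n : ℂ) + 1 ≠ 0 := by exact_mod_cast n.succ_ne_zero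
  have a1 := lc_succ ν n
  have a2 := lc_R1 ν n
  apply mul_right_cancel₀ (pow_ne_zero 2 h)
  rw [pow_succ]
  linear_combination (-2 * (n + 1) - (ν + 1)) * z ^ n * z * a1 + (ν + 1) * z ^ n * z * a2

lemma lF_rel2 (ν z : ℂ) (hz : ‖z‖ < 1) :
    -2 * z * (1 - z) * lD (ν + 1) z = (ν + 1) * (lF ν z - (1 - 2 * z) * lF (ν + 1) z) := by
  have hL := ((has_D1 (ν + 1) z hz).sub ((has_D (ν + 1) z hz).mul_left z)).mul_left (-2)
  have hR := (((has_F1 ν z hz).add ((has_F (ν + 1) z hz).mul_left (2 * z))).sub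
    (has_F1 (ν + 1) z hz)).mul_left (ν + 1)
  have := hL.unique (hR.congr_fun ?_)
  · linear_combination this
  intro n
  have h : (n : ℂ) + 1 ≠ 0 := by exact_mod_cast n.succ_ne_zero
  have a1 := lc_succ ν n
  have a2 := lc_succ (ν + 1) n
  have a3 := lc_R2 ν n
  apply mul_right_cancel₀ (pow_ne_zero 2 h)
  rw [pow_succ]
  linear_combination (-2 * (n + 1) + (ν + 1)) * z ^ n * z * a2 - (ν + 1) * z ^ n * z * a1
    - (ν + 1) * (n - ν) * z ^ n * z * a3


lemma z_norm {x : ℝ} (hx : x ∈ Set.Ioo (-1 : ℝ) 1) : ‖(1 - (x : ℂ)) / 2‖ < 1 := by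
  have : (1 - (x : ℂ)) / 2 = (((1 - x) / 2 : ℝ) : ℂ) := by push_cast; rfl
  rw [this, Complex.norm_real, Real.norm_eq_abs, abs_lt]
  constructor <;> linarith [hx.1, hx.2]

lemma P_deriv (ν : ℂ) {x : ℝ} (hx : x ∈ Set.Ioo (-1 : ℝ) 1) :
    HasDerivAt (legendreP ν) (lD ν ((1 - (x : ℂ)) / 2) * (-1 / 2)) (x : ℂ) := by
  have h1 : HasDerivAt (fun y : ℂ => (1 - y) / 2) (-1 / 2) (x : ℂ) :=
    ((hasDerivAt_id (x : ℂ)).const_sub 1).div_const 2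
  have h2 := (lF_deriv ν _ (z_norm hx)).comp (x : ℂ) h1
  have : legendreP ν = lF ν ∘ fun y : ℂ => (1 - y) / 2 := by
    funext y; exact legendreP_eq ν y
  rw [this]; exact h2

lemma P_rel1 (ν : ℂ) {x : ℝ} (hx : x ∈ Set.Ioo (-1 : ℝ) 1) :
    (1 - (x : ℂ) ^ 2) * (lD ν ((1 - (x : ℂ)) / 2) * (-1 / 2)) =
      (ν + 1) * (x * legendreP ν x - legendreP (ν + 1) x) := by
  have := lF_rel1 ν _ (z_norm hx)
  rw [legendreP_eq, legendreP_eq]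
  linear_combination this

lemma P_rel2 (ν : ℂ) {x : ℝ} (hx : x ∈ Set.Ioo (-1 : ℝ) 1) :
    (1 - (x : ℂ) ^ 2) * (lD (ν + 1) ((1 - (x : ℂ)) / 2) * (-1 / 2)) =
      (ν + 1) * (legendreP ν x - x * legendreP (ν + 1) x) := by
  have := lF_rel2 ν _ (z_norm hx)
  rw [legendreP_eq, legendreP_eq]
  linear_combination this

lemma P_rel3 (ν : ℂ) {x : ℝ} (hx : x ∈ Set.Ioo (-1 : ℝ) 1) :
    (ν + 2) * legendreP (ν + 2) x =
      (2 * ν + 3) * x * legendreP (ν + 1) x - (ν + 1) * legendreP ν x := by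
  have h1 := P_rel2 ν hx
  have h2 := P_rel1 (ν + 1) hx
  rw [show ν + 1 + 1 = ν + 2 by ring] at h2
  linear_combination h2 - h1

lemma one_sub_sq_pos {x : ℝ} (hx : x ∈ Set.Ioo (-1 : ℝ) 1) : 0 < 1 - x ^ 2 := by
  nlinarith [hx.1, hx.2]

lemma W_deriv (ν : ℂ) {x : ℝ} (hx : x ∈ Set.Ioo (-1 : ℝ) 1) :
    HasDerivAt (fun y : ℂ => (1 - y ^ 2) ^ ((ν + 1) / 2))
      (-(ν + 1) * x * (1 - (x : ℂ) ^ 2) ^ ((ν - 1) / 2)) (x : ℂ) := by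
  have h1 : HasDerivAt (fun y : ℂ => 1 - y ^ 2) (-(2 * (x : ℂ))) (x : ℂ) := by
    simpa using (hasDerivAt_pow 2 (x : ℂ)).const_sub 1
  have hs : 1 - (x : ℂ) ^ 2 ∈ slitPlane := by
    have : 1 - (x : ℂ) ^ 2 = ((1 - x ^ 2 : ℝ) : ℂ) := by push_cast; rfl
    rw [this, Complex.ofReal_mem_slitPlane]
    exact one_sub_sq_pos hx
  have h2 := h1.cpow_const (c := (ν + 1) / 2) hs
  convert h2 using 1
  rw [show (ν + 1) / 2 - 1 = (ν - 1) / 2 by ring]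
  ring

lemma W_succ (ν : ℂ) {x : ℝ} (hx : x ∈ Set.Ioo (-1 : ℝ) 1) :
    (1 - (x : ℂ) ^ 2) ^ ((ν + 1) / 2) = (1 - (x : ℂ) ^ 2) ^ ((ν - 1) / 2) * (1 - (x : ℂ) ^ 2) := by
  have : 1 - (x : ℂ) ^ 2 ≠ 0 := by
    have := (one_sub_sq_pos hx).ne'
    exact_mod_cast this
  rw [show (ν + 1) / 2 = (ν - 1) / 2 + 1 by ring, Complex.cpow_add _ _ this, Complex.cpow_one]

lemma G1_deriv (ν : ℂ) {x : ℝ} (hx : x ∈ Set.Ioo (-1 : ℝ) 1) :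
    HasDerivAt (fun y : ℝ => legendreP ν y ^ 2 * legendreP (ν + 1) y *
        (1 - (y : ℂ) ^ 2) ^ ((ν + 1) / 2))
      ((ν + 1) * (legendreP ν x ^ 3 * (1 - (x : ℂ) ^ 2) ^ ((ν - 1) / 2) -
        2 * (legendreP ν x * legendreP (ν + 1) x ^ 2 * (1 - (x : ℂ) ^ 2) ^ ((ν - 1) / 2)))) x := by
  have h := ((((P_deriv ν hx).pow 2).mul (P_deriv (ν + 1) hx)).mul (W_deriv ν hx)).comp_ofReal
  have r1 := P_rel1 ν hx
  have r2 := P_rel2 ν hx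
  refine h.congr_deriv ?_
  simp only [Pi.mul_apply, Pi.pow_apply]
  rw [W_succ ν hx]
  set W := (1 - (x : ℂ) ^ 2) ^ ((ν - 1) / 2)
  set u := legendreP ν x
  set v := legendreP (ν + 1) x
  push_cast
  linear_combination W * (2 * u * v * r1 + u ^ 2 * r2)

lemma G2_deriv (ν : ℂ) {x : ℝ} (hx : x ∈ Set.Ioo (-1 : ℝ) 1) :
    HasDerivAt (fun y : ℝ => legendreP (ν + 1) y ^ 3 *
        (1 - (y : ℂ) ^ 2) ^ ((ν + 1) / 2))
      ((ν + 1) * (3 * (legendreP ν x * legendreP (ν + 1) x ^ 2 * (1 - (x : ℂ) ^ 2) ^ ((ν - 1) / 2)) -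
        4 * (x * legendreP (ν + 1) x ^ 3 * (1 - (x : ℂ) ^ 2) ^ ((ν - 1) / 2)))) x := by
  have h := (((P_deriv (ν + 1) hx).pow 3).mul (W_deriv ν hx)).comp_ofReal
  have r2 := P_rel2 ν hx
  refine h.congr_deriv ?_
  simp only [Pi.pow_apply]
  rw [W_succ ν hx]
  set W := (1 - (x : ℂ) ^ 2) ^ ((ν - 1) / 2)
  set u := legendreP ν x
  set v := legendreP (ν + 1) x
  push_cast
  linear_combination W * (3 * v ^ 2 * r2)

lemma P_bound_log (ν : ℂ) : ∃ C : ℝ, 0 ≤ C ∧ ∀ x ∈ Set.Ioo (-1 : ℝ) 1,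
    ‖legendreP ν x‖ ≤ 1 + C * |Real.log ((1 + x) / 2)| := by
  obtain ⟨C, hC, h⟩ := lc_bound ν
  refine ⟨C, hC, fun x hx => ?_⟩
  have hz := z_norm hx
  have h0 : 0 ≤ (1 - x) / 2 := by linarith [hx.2]
  have h1 : |(1 - x) / 2| < 1 := by rw [abs_lt]; constructor <;> linarith [hx.1, hx.2]
  have hl := (Real.hasSum_pow_div_log_of_abs_lt_one h1).mul_left C
  have hF := has_F1 ν _ hz
  have hb : ‖lF ν ((1 - (x : ℂ)) / 2) - 1‖ ≤ C * -Real.log (1 - (1 - x) / 2) := by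
    refine hF.norm_le_of_bounded hl fun n => ?_
    have : (1 - (x : ℂ)) / 2 = (((1 - x) / 2 : ℝ) : ℂ) := by push_cast; rfl
    rw [norm_mul, norm_pow, this, Complex.norm_real, Real.norm_of_nonneg h0]
    calc _ ≤ C / (n + 1) * ((1 - x) / 2) ^ (n + 1) := by gcongr; exact h n
      _ = _ := by ring
  rw [show 1 - (1 - x) / 2 = (1 + x) / 2 by ring] at hb
  rw [legendreP_eq]
  calc ‖lF ν ((1 - (x : ℂ)) / 2)‖ = ‖1 + (lF ν ((1 - (x : ℂ)) / 2) - 1)‖ := by congr 1; ring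
    _ ≤ 1 + ‖lF ν ((1 - (x : ℂ)) / 2) - 1‖ := by
      refine (norm_add_le _ _).trans ?_; rw [norm_one]
    _ ≤ 1 + C * |Real.log ((1 + x) / 2)| := by
      have := mul_le_mul_of_nonneg_left (neg_le_abs (Real.log ((1 + x) / 2))) hC
      linarith

lemma P_bound (ν : ℂ) {ε : ℝ} (hε : 0 < ε) : ∃ C : ℝ, 0 ≤ C ∧ ∀ x ∈ Set.Ioo (-1 : ℝ) 1,
    ‖legendreP ν x‖ ≤ C * (1 - x ^ 2) ^ (-ε) := by
  obtain ⟨C, hC, h⟩ := P_bound_log ν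
  refine ⟨(1 + C * (1 / ε)) * 4 ^ ε, by positivity, fun x hx => (h x hx).trans ?_⟩
  have hp := one_sub_sq_pos hx
  set y := (1 + x) / 2 with hy
  have hy0 : 0 < y := by rw [hy]; linarith [hx.1]
  have hy1 : y ≤ 1 := by rw [hy]; linarith [hx.2]
  have l := (Real.abs_log_mul_self_rpow_lt y ε hy0 hy1 hε).le
  have hye : 0 < y ^ ε := Real.rpow_pos_of_pos hy0 _
  rw [abs_mul, abs_of_pos hye, ← le_div_iff₀ hye] at l
  have l2 : 1 ≤ 1 / y ^ ε := by
    rw [le_div_iff₀ hye, one_mul]; exact Real.rpow_le_one hy0.le hy1 hε.le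
  have l3 : 1 / y ^ ε ≤ 4 ^ ε * (1 - x ^ 2) ^ (-ε) := by
    have : (1 - x ^ 2) ^ ε ≤ 4 ^ ε * y ^ ε := by
      rw [← Real.mul_rpow (by norm_num) hy0.le]
      apply Real.rpow_le_rpow hp.le _ hε.le
      rw [hy]; nlinarith [hx.1, hx.2]
    rw [Real.rpow_neg hp.le, ← div_eq_mul_inv, div_le_div_iff₀ hye (Real.rpow_pos_of_pos hp _), one_mul]
    exact this
  calc 1 + C * |Real.log y| ≤ 1 / y ^ ε + C * (1 / ε / y ^ ε) := by gcongr
    _ = (1 + C * (1 / ε)) * (1 / y ^ ε) := by ring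
    _ ≤ (1 + C * (1 / ε)) * (4 ^ ε * (1 - x ^ 2) ^ (-ε)) := by gcongr
    _ = _ := by ring

lemma cubic_bound (a b c s : ℂ) {ρ : ℝ} (hρ : ρ < s.re) : ∃ C : ℝ, 0 ≤ C ∧
    ∀ x ∈ Set.Ioo (-1 : ℝ) 1,
    ‖legendreP a x * legendreP b x * legendreP c x * (1 - (x : ℂ) ^ 2) ^ s‖ ≤ C * (1 - x ^ 2) ^ ρ := by
  have hε : 0 < (s.re - ρ) / 3 := by linarith
  obtain ⟨A, hA, hA'⟩ := P_bound a hε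
  obtain ⟨B, hB, hB'⟩ := P_bound b hε
  obtain ⟨D, hD, hD'⟩ := P_bound c hε
  refine ⟨A * B * D, by positivity, fun x hx => ?_⟩
  have hp := one_sub_sq_pos hx
  have e : (1 - (x : ℂ) ^ 2) = ((1 - x ^ 2 : ℝ) : ℂ) := by push_cast; rfl
  rw [norm_mul, norm_mul, norm_mul, e, Complex.norm_cpow_eq_rpow_re_of_pos hp]
  set t := 1 - x ^ 2
  set ε := (s.re - ρ) / 3 with hh
  have : t ^ ρ = t ^ (-ε) * t ^ (-ε) * t ^ (-ε) * t ^ s.re := by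
    rw [← Real.rpow_add hp, ← Real.rpow_add hp, ← Real.rpow_add hp]
    congr 1; rw [hh]; ring
  calc _ ≤ (A * t ^ (-ε)) * (B * t ^ (-ε)) * (D * t ^ (-ε)) * t ^ s.re := by
        gcongr
        · exact hA' x hx
        · exact hB' x hx
        · exact hD' x hx
    _ = _ := by rw [this]; ring

lemma cubic_cont (a b c s : ℂ) : ContinuousOn (fun x : ℝ =>
    legendreP a x * legendreP b x * legendreP c x * (1 - (x : ℂ) ^ 2) ^ s) (Set.Ioo (-1 : ℝ) 1) := by
  intro x hx
  apply ContinuousAt.continuousWithinAt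
  have hP : ∀ a, ContinuousAt (fun x : ℝ => legendreP a x) x := fun a =>
    (P_deriv a hx).comp_ofReal.continuousAt
  have hW := (W_deriv (2 * s - 1) hx).comp_ofReal.continuousAt
  rw [show (2 * s - 1 + 1) / 2 = s by ring] at hW
  exact (((hP a).mul (hP b)).mul (hP c)).mul hW

lemma weight_int {ρ : ℝ} (h1 : -1 < ρ) :
    IntervalIntegrable (fun x : ℝ => (1 - x) ^ ρ + (1 + x) ^ ρ) volume (-1) 1 := by
  have h := intervalIntegrable_rpow' (a := 0) (b := 2) h1
  have a1 := (h.comp_sub_left 1).symm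
  have a2 := h.comp_add_left 1
  norm_num at a1 a2
  exact a1.add a2

lemma cubic_int (a b c s : ℂ) (hs : -1 < s.re) (q : ℝ → ℂ) (hq : Continuous q) :
    IntervalIntegrable (fun x : ℝ => q x * (
    legendreP a x * legendreP b x * legendreP c x * (1 - (x : ℂ) ^ 2) ^ s)) volume (-1) 1 := by
  obtain ⟨ρ, r1, r2⟩ := exists_between (lt_min hs (by norm_num : (-1 : ℝ) < 0))
  obtain ⟨C, hC, h⟩ := cubic_bound a b c s (r2.trans_le (min_le_left _ _))
  have r3 : ρ < 0 := r2.trans_le (min_le_right _ _)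
  suffices IntervalIntegrable (fun x : ℝ =>
    legendreP a x * legendreP b x * legendreP c x * (1 - (x : ℂ) ^ 2) ^ s) volume (-1) 1 from
    this.continuousOn_mul hq.continuousOn
  have hw := (weight_int r1).const_mul C
  rw [intervalIntegrable_iff_integrableOn_Ioo_of_le (by norm_num)] at hw ⊢
  refine Integrable.mono' hw ((cubic_cont a b c s).aestronglyMeasurable measurableSet_Ioo) ?_
  refine (ae_restrict_mem measurableSet_Ioo).mono fun x hx => (h x hx).trans ?_
  gcongr
  have p1 : 0 < 1 - x := by linarith [hx.2]
  have p2 : 0 < 1 + x := by linarith [hx.1]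
  rcases le_total 0 x with h0 | h0
  · have : (1 - x ^ 2) ^ ρ ≤ (1 - x) ^ ρ :=
      Real.rpow_le_rpow_of_nonpos p1 (by nlinarith) r3.le
    have := Real.rpow_nonneg p2.le ρ
    linarith
  · have : (1 - x ^ 2) ^ ρ ≤ (1 + x) ^ ρ :=
      Real.rpow_le_rpow_of_nonpos p2 (by nlinarith) r3.le
    have := Real.rpow_nonneg p1.le ρ
    linarith

open Filter Topology in
lemma cubic_lim (a b c s : ℂ) (hs : 0 < s.re) (x₀ : ℝ) (h0 : x₀ ^ 2 = 1) (l : Filter ℝ)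
    (hl : l ≤ 𝓝 x₀) (hl2 : Set.Ioo (-1 : ℝ) 1 ∈ l) :
    Tendsto (fun x : ℝ =>
      legendreP a x * legendreP b x * legendreP c x * (1 - (x : ℂ) ^ 2) ^ s) l (𝓝 0) := by
  obtain ⟨C, hC, h⟩ := cubic_bound a b c s (show s.re / 2 < s.re by linarith)
  have hc : ContinuousAt (fun x : ℝ => C * (1 - x ^ 2) ^ (s.re / 2)) x₀ := by
    apply ContinuousAt.mul continuousAt_const
    apply ContinuousAt.rpow_const (by fun_prop)
    right; linarith
  have ht : Tendsto (fun x : ℝ => C * (1 - x ^ 2) ^ (s.re / 2)) l (𝓝 0) := by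
    have := hc.tendsto.mono_left hl
    rw [h0, sub_self, Real.zero_rpow (by linarith), mul_zero] at this
    exact this
  refine squeeze_zero_norm' ?_ ht
  filter_upwards [hl2] with x hx using h x hx

theorem stmt12 (ν : ℂ) (hν : -1 < ν.re) :
    (∫ x in (-1:ℝ)..1, (legendreP ν (x : ℂ)) ^ 3 * ((1 - (x:ℂ) ^ 2) ^ ((ν - 1)/2)))
      = (8 * (ν + 2) / (2 * ν + 5)) *
        ∫ x in (-1:ℝ)..1, legendreP (ν + 2) (x : ℂ) * (legendreP (ν + 1) (x : ℂ)) ^ 2 *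
          ((1 - (x:ℂ) ^ 2) ^ ((ν - 1)/2)) := by
  have n1 : ν + 1 ≠ 0 := fun h => by have := congrArg Complex.re h; simp at this; linarith
  have n2 : ν + 2 ≠ 0 := fun h => by have := congrArg Complex.re h; simp at this; linarith
  have n5 : 2 * ν + 5 ≠ 0 := fun h => by have := congrArg Complex.re h; simp at this; linarith
  have hs : -1 < ((ν - 1) / 2).re := by
    rw [show (ν - 1) / 2 = ((1 / 2 : ℝ) : ℂ) * (ν - 1) by push_cast; ring, Complex.re_ofReal_mul]
    simp; linarith
  have hs' : 0 < ((ν + 1) / 2).re := by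
    rw [show (ν + 1) / 2 = ((1 / 2 : ℝ) : ℂ) * (ν + 1) by push_cast; ring, Complex.re_ofReal_mul]
    simp; linarith
  have i1 : IntervalIntegrable (fun x : ℝ => legendreP ν x ^ 3 * (1 - (x : ℂ) ^ 2) ^ ((ν - 1) / 2))
      volume (-1) 1 := by
    refine (cubic_int ν ν ν _ hs (fun _ => 1) continuous_const).congr (fun x _ => ?_)
    ring
  have i2 : IntervalIntegrable (fun x : ℝ => legendreP ν x * legendreP (ν + 1) x ^ 2 *
      (1 - (x : ℂ) ^ 2) ^ ((ν - 1) / 2)) volume (-1) 1 := by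
    refine (cubic_int ν (ν + 1) (ν + 1) _ hs (fun _ => 1) continuous_const).congr (fun x _ => ?_)
    ring
  have i3 : IntervalIntegrable (fun x : ℝ => x * legendreP (ν + 1) x ^ 3 *
      (1 - (x : ℂ) ^ 2) ^ ((ν - 1) / 2)) volume (-1) 1 := by
    refine (cubic_int (ν + 1) (ν + 1) (ν + 1) _ hs (fun x => x) (by fun_prop)).congr (fun x _ => ?_)
    ring
  have m1 : Set.Ioo (-1 : ℝ) 1 ∈ nhdsWithin (-1 : ℝ) (Set.Ioi (-1)) := Ioo_mem_nhdsGT (by norm_num)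
  have m2 : Set.Ioo (-1 : ℝ) 1 ∈ nhdsWithin (1 : ℝ) (Set.Iio 1) := Ioo_mem_nhdsLT (by norm_num)
  have e1 := integral_eq_sub_of_hasDerivAt_of_tendsto (by norm_num : (-1 : ℝ) < 1)
    (fun x hx => G1_deriv ν hx) ((i1.sub (i2.const_mul 2)).const_mul (ν + 1))
    (by simpa only [sq] using cubic_lim ν ν (ν + 1) _ hs' (-1) (by norm_num) _ nhdsWithin_le_nhds m1)
    (by simpa only [sq] using cubic_lim ν ν (ν + 1) _ hs' 1 (by norm_num) _ nhdsWithin_le_nhds m2)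
  have e2 := integral_eq_sub_of_hasDerivAt_of_tendsto (by norm_num : (-1 : ℝ) < 1)
    (fun x hx => G2_deriv ν hx) (((i2.const_mul 3).sub (i3.const_mul 4)).const_mul (ν + 1))
    (by simpa only [pow_succ, pow_zero, one_mul] using cubic_lim (ν + 1) (ν + 1) (ν + 1) _ hs' (-1) (by norm_num) _ nhdsWithin_le_nhds m1)
    (by simpa only [pow_succ, pow_zero, one_mul] using cubic_lim (ν + 1) (ν + 1) (ν + 1) _ hs' 1 (by norm_num) _ nhdsWithin_le_nhds m2)
  rw [intervalIntegral.integral_const_mul, intervalIntegral.integral_sub i1 (i2.const_mul 2),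
    intervalIntegral.integral_const_mul, sub_self] at e1
  rw [intervalIntegral.integral_const_mul,
    intervalIntegral.integral_sub (i2.const_mul 3) (i3.const_mul 4),
    intervalIntegral.integral_const_mul, intervalIntegral.integral_const_mul, sub_self] at e2
  have e3 : (ν + 2) * ∫ x in (-1:ℝ)..1, legendreP (ν + 2) (x : ℂ) * (legendreP (ν + 1) (x : ℂ)) ^ 2 *
          ((1 - (x:ℂ) ^ 2) ^ ((ν - 1)/2)) =
      (2 * ν + 3) * (∫ x in (-1:ℝ)..1, x * legendreP (ν + 1) x ^ 3 * (1 - (x : ℂ) ^ 2) ^ ((ν - 1) / 2)) -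
      (ν + 1) * (∫ x in (-1:ℝ)..1, legendreP ν x * legendreP (ν + 1) x ^ 2 *
        (1 - (x : ℂ) ^ 2) ^ ((ν - 1) / 2)) := by
    rw [← intervalIntegral.integral_const_mul, ← intervalIntegral.integral_const_mul,
      ← intervalIntegral.integral_const_mul,
      ← intervalIntegral.integral_sub (i3.const_mul _) (i2.const_mul _)]
    rw [intervalIntegral.integral_of_le (by norm_num), intervalIntegral.integral_of_le (by norm_num),
      integral_Ioc_eq_integral_Ioo, integral_Ioc_eq_integral_Ioo]
    refine setIntegral_congr_fun measurableSet_Ioo fun x hx => ?_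
    have := P_rel3 ν hx
    linear_combination legendreP (ν + 1) x ^ 2 * (1 - (x : ℂ) ^ 2) ^ ((ν - 1) / 2) * this
  have e1' := (mul_eq_zero.1 e1).resolve_left n1
  have e2' := (mul_eq_zero.1 e2).resolve_left n1
  rw [div_mul_eq_mul_div, eq_div_iff n5]
  linear_combination (2 * ν + 5) * e1' - 8 * e3 + 2 * (2 * ν + 3) * e2'
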